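/- Let q be a prime power and let m : F_q → ℕ be a fixed function with D(m) := Σ_{λ∈F_q} m(λ) finite. Define α_m(n, q) := |C_m(n, q)| / q^{n²}. Then the limit α_m(∞, q) := lim_{n→∞} α_m(n, q) exists and equals c(q)^q · ∏_{λ∈F_q} q^{−m(λ)} / c_{m(λ)}(q). -/

import Mathlib

open Matrix Polynomial Filter

theorem rootMultiplicity_X_sub_C_pow_mul {F : Type*} [Field F] {a : F} {g : F[X]}
    (hg : g.eval a ≠ 0) (d : ℕ) : ((X - C a) ^ d * g).rootMultiplicity a = d := by
  have hg0 : g ≠ 0 := by rintro rfl; simp at hg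
  rw [rootMultiplicity_mul (mul_ne_zero (pow_ne_zero _ (X_sub_C_ne_zero a)) hg0),
    rootMultiplicity_X_sub_C_pow, rootMultiplicity_eq_zero hg, add_zero]

theorem exists_units_conj_fromBlocks {F : Type*} [Field F] {k l : ℕ} (lam : F)
    (A : Matrix (Fin k ⊕ Fin l) (Fin k ⊕ Fin l) F)
    (hA : A.charpoly.rootMultiplicity lam = k) :
    ∃ (g : (Matrix (Fin k ⊕ Fin l) (Fin k ⊕ Fin l) F)ˣ) (N : Matrix (Fin k) (Fin k) F)
      (B : Matrix (Fin l) (Fin l) F), N.charpoly = (X - C lam) ^ k ∧ B.charpoly.eval lam ≠ 0 ∧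
        g.val * fromBlocks N 0 0 B * g⁻¹.val = A := by
  set f := toLin' A with hf
  set φ : Module.End F (Fin k ⊕ Fin l → F) := f - lam • 1 with hφ
  obtain ⟨n, hn, hn1⟩ := (φ.eventually_isCompl_ker_pow_range_pow.and
    (eventually_ge_atTop 1)).exists
  have hcomm : Commute f φ := by
    rw [hφ]
    exact (Commute.refl f).sub_right ((Commute.one_right f).smul_right lam)
  have hcn : Commute f (φ ^ n) := hcomm.pow_right n
  set U := LinearMap.ker (φ ^ n) with hU
  set W := LinearMap.range (φ ^ n) with hW
  have hfU : ∀ x ∈ U, f x ∈ U := by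
    intro x hx
    rw [hU, LinearMap.mem_ker] at hx ⊢
    rw [← Module.End.mul_apply, ← hcn.eq, Module.End.mul_apply, hx, map_zero]
  have hfW : ∀ x ∈ W, f x ∈ W := by
    rintro _ ⟨x, rfl⟩
    exact ⟨f x, by rw [← Module.End.mul_apply, ← hcn.eq, Module.End.mul_apply]⟩
  set fU := f.restrict hfU with hfUd
  set fW := f.restrict hfW with hfWd
  set e := Submodule.prodEquivOfIsCompl U W hn with he
  have hconj : e.conj (fU.prodMap fW) = f := by
    rw [LinearEquiv.conj_apply, LinearEquiv.comp_toLinearMap_symm_eq]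
    ext x <;> simp [he, hfUd, hfWd, LinearMap.restrict_apply]
  have hchar : A.charpoly = fU.charpoly * fW.charpoly := by
    rw [← LinearMap.charpoly_prodMap, ← e.charpoly_conj, hconj, hf, Matrix.charpoly_toLin']
  have hUnil : IsNilpotent (fU - lam • 1) := by
    refine ⟨n, ?_⟩
    have h1 : ∀ (j : ℕ) (x : U), (((fU - lam • 1) ^ j) x : Fin k ⊕ Fin l → F) = (φ ^ j) x := by
      intro j
      induction j with
      | zero => simp
      | succ j ih =>
        intro x
        rw [pow_succ, pow_succ, Module.End.mul_apply, Module.End.mul_apply, ih]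
        simp [hφ, hfUd, LinearMap.restrict_apply]
    ext x : 2
    rw [h1]
    exact x.2
  have hUchar : fU.charpoly = (X - C lam) ^ Module.finrank F U := by
    have h1 := hUnil.charpoly_eq_X_pow_finrank
    rw [LinearMap.charpoly_sub_smul] at h1
    have h2 := congrArg (fun p : F[X] => p.comp (X - C lam)) h1
    simpa [comp_assoc] using h2
  have hWchar : fW.charpoly.eval lam ≠ 0 := by
    rw [LinearMap.eval_charpoly]
    intro h0
    have h1 := LinearMap.bot_lt_ker_of_det_eq_zero h0
    obtain ⟨w, hw, hw0⟩ := Submodule.exists_mem_ne_zero_of_ne_bot h1.ne'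
    apply hw0
    have h2 : φ w = 0 := by
      have := congrArg (Subtype.val) (LinearMap.mem_ker.mp hw)
      simp [hfWd, LinearMap.restrict_apply] at this
      rw [hφ, ← neg_eq_zero]
      simpa using this
    have h3 : (w : Fin k ⊕ Fin l → F) ∈ U := by
      rw [hU, LinearMap.mem_ker, ← Nat.sub_add_cancel hn1, pow_succ, Module.End.mul_apply, h2,
        map_zero]
    exact Subtype.ext (Submodule.disjoint_def.mp hn.disjoint _ h3 w.2)
  have hUk : Module.finrank F U = k := by
    rw [hchar, hUchar, rootMultiplicity_X_sub_C_pow_mul hWchar] at hA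
    exact hA
  have hWl : Module.finrank F W = l := by
    have := Submodule.finrank_add_eq_of_isCompl hn
    simp at this
    omega
  let bU := Module.finBasisOfFinrankEq F U hUk
  let bW := Module.finBasisOfFinrankEq F W hWl
  let b := (bU.prod bW).map e
  let b' := Pi.basisFun F (Fin k ⊕ Fin l)
  have hb : LinearMap.toMatrix b b f =
      fromBlocks (LinearMap.toMatrix bU bU fU) 0 0 (LinearMap.toMatrix bW bW fW) := by
    rw [← LinearMap.toMatrix_prodMap]
    ext i j
    rw [← hconj]
    simp only [LinearMap.toMatrix_apply, b]
    simp
  refine ⟨⟨b'.toMatrix b, b.toMatrix b', b'.toMatrix_mul_toMatrix_flip b,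
    b.toMatrix_mul_toMatrix_flip b'⟩, LinearMap.toMatrix bU bU fU, LinearMap.toMatrix bW bW fW,
    ?_, ?_, ?_⟩
  · rw [LinearMap.charpoly_toMatrix, hUchar, hUk]
  · rwa [LinearMap.charpoly_toMatrix]
  · rw [← hb]
    simp only [Units.inv_mk]
    rw [basis_toMatrix_mul_linearMap_toMatrix_mul_basis_toMatrix]
    simp [b', hf, LinearMap.toMatrix_eq_toMatrix']

theorem intertwine_eq_zero {F : Type*} [Field F] {k l : ℕ} {lam : F}
    {N : Matrix (Fin k) (Fin k) F} {B : Matrix (Fin l) (Fin l) F} {b : Matrix (Fin k) (Fin l) F}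
    (hN : N.charpoly = (X - C lam) ^ k) (hB : B.charpoly.eval lam ≠ 0)
    (h : N * b = b * B) : b = 0 := by
  have h1 : ∀ j : ℕ, (N - scalar _ lam) ^ j * b = b * (B - scalar _ lam) ^ j := by
    intro j
    induction j with
    | zero => simp
    | succ j ih =>
      rw [pow_succ', Matrix.mul_assoc, ih, ← Matrix.mul_assoc, pow_succ',
        ← Matrix.mul_assoc, Matrix.sub_mul, Matrix.mul_sub, h]
      simp [← smul_eq_diagonal_mul, ← smul_eq_mul_diagonal]
  have h2 : (N - scalar _ lam) ^ k = 0 := by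
    have := aeval_self_charpoly N
    rw [hN] at this
    simpa [algebraMap_eq_diagonal, Pi.algebraMap_def] using this
  have h3 : IsUnit (B - scalar _ lam) := by
    rw [Matrix.isUnit_iff_isUnit_det]
    rw [eval_charpoly] at hB
    rw [← neg_sub, Matrix.det_neg]
    exact (IsUnit.pow _ (isUnit_one.neg)).mul hB.isUnit
  have h4 := h1 k
  rw [h2, Matrix.zero_mul] at h4
  obtain ⟨u, hu⟩ := h3.pow k
  rw [← hu] at h4
  have := congrArg (· * u⁻¹.val) h4
  simpa [Matrix.mul_assoc] using this.symm

theorem intertwine_eq_zero' {F : Type*} [Field F] {k l : ℕ} {lam : F}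
    {N : Matrix (Fin k) (Fin k) F} {B : Matrix (Fin l) (Fin l) F} {b : Matrix (Fin l) (Fin k) F}
    (hN : N.charpoly = (X - C lam) ^ k) (hB : B.charpoly.eval lam ≠ 0)
    (h : B * b = b * N) : b = 0 := by
  rw [← transpose_eq_zero]
  refine intertwine_eq_zero (N := Nᵀ) (B := Bᵀ) (lam := lam) ?_ ?_ ?_
  · rwa [charpoly_transpose]
  · rwa [charpoly_transpose]
  · rw [← transpose_mul, ← transpose_mul, h]

theorem charpoly_units_conj_fromBlocks {F : Type*} [Field F] {k l : ℕ}
    (g : (Matrix (Fin k ⊕ Fin l) (Fin k ⊕ Fin l) F)ˣ) (N : Matrix (Fin k) (Fin k) F)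
    (B : Matrix (Fin l) (Fin l) F) :
    (g.val * fromBlocks N 0 0 B * g⁻¹.val).charpoly = N.charpoly * B.charpoly := by
  rw [coe_units_inv, charpoly_units_conj, charpoly_fromBlocks_zero₁₂]

/-- The block-diagonal embedding of `GL_k × GL_l` into `GL_{k + l}`. -/
def blockUnits {F : Type*} [Field F] {k l : ℕ} (a : GL (Fin k) F) (d : GL (Fin l) F) :
    (Matrix (Fin k ⊕ Fin l) (Fin k ⊕ Fin l) F)ˣ where
  val := fromBlocks a.val 0 0 d.val
  inv := fromBlocks a⁻¹.val 0 0 d⁻¹.val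
  val_inv := by rw [fromBlocks_multiply]; simp
  inv_val := by rw [fromBlocks_multiply]; simp

theorem exists_eq_blockUnits {F : Type*} [Field F] {k l : ℕ} {lam : F}
    {N N' : Matrix (Fin k) (Fin k) F} {B B' : Matrix (Fin l) (Fin l) F}
    (hN : N.charpoly = (X - C lam) ^ k) (hN' : N'.charpoly = (X - C lam) ^ k)
    (hB : B.charpoly.eval lam ≠ 0) (hB' : B'.charpoly.eval lam ≠ 0)
    (h : (Matrix (Fin k ⊕ Fin l) (Fin k ⊕ Fin l) F)ˣ)
    (hh : fromBlocks N' 0 0 B' * h.val = h.val * fromBlocks N 0 0 B) :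
    ∃ a d, h = blockUnits a d ∧ N' = a.val * N * a⁻¹.val ∧ B' = d.val * B * d⁻¹.val := by
  have key : ∀ (N N' : Matrix (Fin k) (Fin k) F) (B B' : Matrix (Fin l) (Fin l) F)
    (_ : N.charpoly = (X - C lam) ^ k) (_ : N'.charpoly = (X - C lam) ^ k)
    (_ : B.charpoly.eval lam ≠ 0) (_ : B'.charpoly.eval lam ≠ 0)
    (h : Matrix (Fin k ⊕ Fin l) (Fin k ⊕ Fin l) F)
    (_ : fromBlocks N' 0 0 B' * h = h * fromBlocks N 0 0 B),
    ∃ a d, h = fromBlocks a 0 0 d ∧ N' * a = a * N ∧ B' * d = d * B := by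
    intro N N' B B' hN hN' hB hB' h hh
    rw [← fromBlocks_toBlocks h, fromBlocks_multiply, fromBlocks_multiply] at hh
    simp only [Matrix.zero_mul, Matrix.mul_zero, add_zero, zero_add, fromBlocks_inj] at hh
    obtain ⟨h1, h2, h3, h4⟩ := hh
    refine ⟨h.toBlocks₁₁, h.toBlocks₂₂, ?_, h1, h4⟩
    conv_lhs => rw [← fromBlocks_toBlocks h]
    rw [intertwine_eq_zero hN' hB h2, intertwine_eq_zero' hN hB' h3]
  obtain ⟨a, d, h1, h2, h3⟩ := key N N' B B' hN hN' hB hB' h.val hh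
  obtain ⟨a', d', h1', -, -⟩ := key N' N B' B hN' hN hB' hB h⁻¹.val (by
    have := congrArg (fun M => h⁻¹.val * M * h⁻¹.val) hh
    simpa [Matrix.mul_assoc] using this.symm)
  have e1 := h.mul_inv
  have e2 := h.inv_mul
  rw [h1, h1', fromBlocks_multiply, ← fromBlocks_one, fromBlocks_inj] at e1 e2
  simp only [Matrix.zero_mul, Matrix.mul_zero, add_zero, zero_add] at e1 e2
  refine ⟨⟨a, a', e1.1, e2.1⟩, ⟨d, d', e1.2.2.2, e2.2.2.2⟩, Units.ext h1, ?_, ?_⟩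
  · rw [Units.val_mk, ← h2, Matrix.mul_assoc]
    simp [e1.1]
  · rw [Units.val_mk, ← h3, Matrix.mul_assoc]
    simp [e1.2.2.2]

theorem card_rootMultiplicity_mul_card_GL {F : Type*} [Field F] [Fintype F] (k l : ℕ) (lam : F)
    (Q : F[X] → Prop) (hQ : ∀ f : F[X], f.Monic → (Q ((X - C lam) ^ k * f) ↔ Q f)) :
    Nat.card {A : Matrix (Fin k ⊕ Fin l) (Fin k ⊕ Fin l) F //
        A.charpoly.rootMultiplicity lam = k ∧ Q A.charpoly}
      * (Nat.card (GL (Fin k) F) * Nat.card (GL (Fin l) F)) =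
    Nat.card (Matrix (Fin k ⊕ Fin l) (Fin k ⊕ Fin l) F)ˣ *
      (Nat.card {N : Matrix (Fin k) (Fin k) F // N.charpoly = (X - C lam) ^ k} *
       Nat.card {B : Matrix (Fin l) (Fin l) F // B.charpoly.eval lam ≠ 0 ∧ Q B.charpoly}) := by
  simp_rw [← Nat.card_prod]
  have hex : ∀ A : {A : Matrix (Fin k ⊕ Fin l) (Fin k ⊕ Fin l) F //
        A.charpoly.rootMultiplicity lam = k ∧ Q A.charpoly},
      ∃ x : (Matrix (Fin k ⊕ Fin l) (Fin k ⊕ Fin l) F)ˣ ×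
        ({N : Matrix (Fin k) (Fin k) F // N.charpoly = (X - C lam) ^ k} ×
        {B : Matrix (Fin l) (Fin l) F // B.charpoly.eval lam ≠ 0 ∧ Q B.charpoly}),
        x.1.val * fromBlocks x.2.1.val 0 0 x.2.2.val * x.1⁻¹.val = A.val := by
    rintro ⟨A, hA, hQA⟩
    obtain ⟨g, N, B, hN, hB, rfl⟩ := exists_units_conj_fromBlocks lam A hA
    rw [charpoly_units_conj_fromBlocks, hN, hQ _ B.charpoly_monic] at hQA
    exact ⟨⟨g, ⟨N, hN⟩, ⟨B, hB, hQA⟩⟩, rfl⟩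
  choose s hs using hex
  have conj_charpoly : ∀ {n : ℕ} (a : GL (Fin n) F) (N : Matrix (Fin n) (Fin n) F),
      (a.val * N * a⁻¹.val).charpoly = N.charpoly := fun a N => by
    rw [coe_units_inv, charpoly_units_conj]
  let Ψ : {A : Matrix (Fin k ⊕ Fin l) (Fin k ⊕ Fin l) F //
        A.charpoly.rootMultiplicity lam = k ∧ Q A.charpoly} × (GL (Fin k) F × GL (Fin l) F) →
      (Matrix (Fin k ⊕ Fin l) (Fin k ⊕ Fin l) F)ˣ ×
        ({N : Matrix (Fin k) (Fin k) F // N.charpoly = (X - C lam) ^ k} ×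
        {B : Matrix (Fin l) (Fin l) F // B.charpoly.eval lam ≠ 0 ∧ Q B.charpoly}) := fun y =>
    ((s y.1).1 * (blockUnits y.2.1 y.2.2)⁻¹,
      ⟨y.2.1.val * (s y.1).2.1.val * y.2.1⁻¹.val, by
        rw [conj_charpoly]; exact (s y.1).2.1.2⟩,
      ⟨y.2.2.val * (s y.1).2.2.val * y.2.2⁻¹.val, by
        rw [conj_charpoly]; exact (s y.1).2.2.2⟩)
  have hΨ : ∀ y, (Ψ y).1.val * fromBlocks (Ψ y).2.1.val 0 0 (Ψ y).2.2.val * (Ψ y).1⁻¹.val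
      = y.1.val := by
    rintro ⟨A, a, d⟩
    have h1 : fromBlocks (a.val * (s A).2.1.val * a⁻¹.val) 0 0 (d.val * (s A).2.2.val * d⁻¹.val) =
      (blockUnits a d).val * fromBlocks (s A).2.1.val 0 0 (s A).2.2.val *
        (blockUnits a d)⁻¹.val := by
      change _ = fromBlocks _ _ _ _ * _ * fromBlocks _ _ _ _
      simp [fromBlocks_multiply]
    simp only [Ψ]
    rw [h1, ← hs A]
    simp [Matrix.mul_assoc]
  refine Nat.card_eq_of_bijective Ψ ⟨?_, ?_⟩
  · rintro ⟨A, a, d⟩ ⟨A', a', d'⟩ h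
    have h1 : A = A' := Subtype.ext ((hΨ ⟨A, a, d⟩).symm.trans (h ▸ hΨ ⟨A', a', d'⟩))
    subst h1
    have h2 := congrArg Prod.fst h
    simp only [Ψ, mul_right_inj, _root_.inv_inj] at h2
    have h3 := congrArg Units.val h2
    simp only [blockUnits, fromBlocks_inj] at h3
    rw [Units.ext h3.1, Units.ext h3.2.2.2]
  · rintro ⟨g, ⟨N, hN⟩, ⟨B, hB, hQB⟩⟩
    have hA : (g.val * fromBlocks N 0 0 B * g⁻¹.val).charpoly = (X - C lam) ^ k * B.charpoly := by
      rw [charpoly_units_conj_fromBlocks, hN]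
    let A : {A : Matrix (Fin k ⊕ Fin l) (Fin k ⊕ Fin l) F //
        A.charpoly.rootMultiplicity lam = k ∧ Q A.charpoly} :=
      ⟨g.val * fromBlocks N 0 0 B * g⁻¹.val, by
        rw [hA]
        exact ⟨rootMultiplicity_X_sub_C_pow_mul hB k, (hQ _ B.charpoly_monic).mpr hQB⟩⟩
    obtain ⟨a, d, h1, h2, h3⟩ := exists_eq_blockUnits (s A).2.1.2 hN (s A).2.2.2.1 hB
      (g⁻¹ * (s A).1) (by
        have := congrArg (fun M => g⁻¹.val * M * (s A).1.val) (hs A)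
        simpa [A, Matrix.mul_assoc] using this.symm)
    refine ⟨⟨A, a, d⟩, ?_⟩
    simp only [Ψ]
    refine Prod.ext ?_ (Prod.ext (Subtype.ext h2.symm) (Subtype.ext h3.symm))
    rw [← h1]
    simp

theorem one_sub_pow_pos {x : ℝ} (hx : 0 < x) (hx1 : x ≤ 1 / 2) {i : ℕ} (hi : 1 ≤ i) :
    0 < 1 - x ^ i :=
  sub_pos.mpr (pow_lt_one₀ hx.le (by linarith) (by omega))

theorem prod_one_sub_pow_pos {x : ℝ} (hx : 0 < x) (hx1 : x ≤ 1 / 2) (n : ℕ) :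
    0 < ∏ i ∈ Finset.Icc 1 n, (1 - x ^ i) :=
  Finset.prod_pos fun _ hi => one_sub_pow_pos hx hx1 (Finset.mem_Icc.mp hi).1

theorem quarter_le_prod_one_sub_pow {x : ℝ} (hx : 0 < x) (hx1 : x ≤ 1 / 2) (n : ℕ) :
    1 / 4 ≤ ∏ i ∈ Finset.Icc 1 n, (1 - x ^ i) := by
  have key : ∀ n : ℕ, 1 / 4 + (1 / 2 : ℝ) ^ (n + 2) ≤ ∏ i ∈ Finset.Icc 1 (n + 1), (1 - x ^ i) := by
    intro n
    induction n with
    | zero => norm_num; linarith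
    | succ n ih =>
      rw [Finset.prod_Icc_succ_top (by omega)]
      have h1 : x ^ (n + 2) ≤ (1 / 2 : ℝ) ^ (n + 2) := by gcongr
      have h2 : (1 / 2 : ℝ) ^ (n + 2) ≤ 1 / 4 := by
        rw [pow_add]
        have : (1 / 2 : ℝ) ^ n ≤ 1 := pow_le_one₀ (by norm_num) (by norm_num)
        linarith
      have h3 : 0 < (1 / 2 : ℝ) ^ (n + 2) := by positivity
      calc 1 / 4 + (1 / 2 : ℝ) ^ (n + 1 + 2)
          ≤ (1 / 4 + (1 / 2 : ℝ) ^ (n + 2)) * (1 - (1 / 2 : ℝ) ^ (n + 2)) := by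
            rw [show n + 1 + 2 = (n + 2) + 1 by ring, pow_succ _ (n + 2)]
            nlinarith
        _ ≤ _ := by
            refine mul_le_mul ih (by linarith) (by linarith) ?_
            exact (prod_one_sub_pow_pos hx hx1 _).le
  cases n with
  | zero => norm_num
  | succ n => exact le_trans (by simp) (key n)

/-- The coefficients of `∏_{i ≥ 1} (1 - x ^ i u)⁻¹`. -/
noncomputable def eulerCoeff (x : ℝ) (n : ℕ) : ℝ := x ^ n / ∏ i ∈ Finset.Icc 1 n, (1 - x ^ i)

/-- The coefficients of `∏_{i ≥ 1} (1 - x ^ i u)`. -/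
noncomputable def eulerInvCoeff (x : ℝ) (n : ℕ) : ℝ :=
  ∏ i ∈ Finset.Icc 1 n, (-(x ^ i / (1 - x ^ i)))

theorem summable_eulerInvCoeff {x : ℝ} (hx : 0 < x) (hx1 : x ≤ 1 / 2) :
    Summable (eulerInvCoeff x) := by
  have hne : ∀ n, eulerInvCoeff x n ≠ 0 := by
    refine fun n => Finset.prod_ne_zero_iff.mpr fun i hi => ?_
    have := one_sub_pow_pos hx hx1 (Finset.mem_Icc.mp hi).1
    have := pow_pos hx i
    exact neg_ne_zero.mpr (by positivity)
  refine summable_of_ratio_test_tendsto_lt_one (l := 0) one_pos (Eventually.of_forall hne) ?_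
  have h0 : Tendsto (fun n => x ^ (n + 1)) atTop (nhds 0) :=
    (tendsto_add_atTop_iff_nat 1).mpr (tendsto_pow_atTop_nhds_zero_of_lt_one hx.le (by linarith))
  have h1 : Tendsto (fun n => x ^ (n + 1) / (1 - x ^ (n + 1))) atTop (nhds 0) := by
    have := h0.div (h0.const_sub 1) (by norm_num)
    rwa [zero_div] at this
  refine h1.congr fun n => ?_
  have hs : eulerInvCoeff x (n + 1) =
      eulerInvCoeff x n * (-(x ^ (n + 1) / (1 - x ^ (n + 1)))) :=
    Finset.prod_Icc_succ_top (by omega) _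
  have h2 := one_sub_pow_pos hx hx1 (i := n + 1) (by omega)
  rw [hs, norm_mul, mul_div_cancel_left₀ _ (norm_ne_zero_iff.mpr (hne n)), norm_neg, Real.norm_eq_abs,
    abs_of_pos (by positivity)]

theorem eulerInvCoeff_mul_eulerCoeff {x : ℝ} (hx : 0 < x) (hx1 : x ≤ 1 / 2) :
    PowerSeries.mk (eulerInvCoeff x) * PowerSeries.mk (eulerCoeff x) = 1 := by
  set E := PowerSeries.mk (eulerInvCoeff x)
  set B := PowerSeries.mk (eulerCoeff x)
  have hB : PowerSeries.rescale x B = (1 - PowerSeries.C x * PowerSeries.X) * B := by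
    ext n
    cases n with
    | zero => simp [B, sub_mul, mul_assoc]
    | succ n =>
      have h1 := (prod_one_sub_pow_pos hx hx1 n).ne'
      have h2 := (one_sub_pow_pos hx hx1 (i := n + 1) (by omega)).ne'
      simp only [PowerSeries.coeff_rescale, B, PowerSeries.coeff_mk, sub_mul, one_mul, map_sub,
        mul_assoc, PowerSeries.coeff_C_mul, PowerSeries.coeff_succ_X_mul, eulerCoeff,
        Finset.prod_Icc_succ_top (show 1 ≤ n + 1 by omega)]
      field_simp
      ring
  have hE : E = (1 - PowerSeries.C x * PowerSeries.X) * PowerSeries.rescale x E := by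
    ext n
    cases n with
    | zero =>
      have h0 : PowerSeries.constantCoeff (PowerSeries.rescale x E) =
          PowerSeries.constantCoeff E := by
        rw [← PowerSeries.coeff_zero_eq_constantCoeff_apply, PowerSeries.coeff_rescale]
        simp
      simp [sub_mul, mul_assoc, h0]
    | succ n =>
      have h2 := (one_sub_pow_pos hx hx1 (i := n + 1) (by omega)).ne'
      simp only [PowerSeries.coeff_rescale, E, PowerSeries.coeff_mk, sub_mul, one_mul, map_sub,
        mul_assoc, PowerSeries.coeff_C_mul, PowerSeries.coeff_succ_X_mul, eulerInvCoeff,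
        Finset.prod_Icc_succ_top (show 1 ≤ n + 1 by omega)]
      field_simp
      ring
  have hEB : PowerSeries.rescale x (E * B) = E * B := by
    rw [map_mul, hB]
    conv_rhs => rw [hE]
    ring
  ext n
  cases n with
  | zero => simp [E, B, eulerCoeff, eulerInvCoeff]
  | succ n =>
    have h1 := congrArg (PowerSeries.coeff (n + 1)) hEB
    rw [PowerSeries.coeff_rescale] at h1
    have h2 := (one_sub_pow_pos hx hx1 (i := n + 1) (by omega)).ne'
    rw [PowerSeries.coeff_one, if_neg (by omega)]
    exact (mul_eq_zero.mp (show (1 - x ^ (n + 1)) * PowerSeries.coeff (n + 1) (E * B) = 0 by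
      linarith)).resolve_left h2

theorem tendsto_convolution {e y : ℕ → ℝ} {L : ℝ} (he : Summable e)
    (hy : Tendsto y atTop (nhds L)) :
    Tendsto (fun n => ∑ p ∈ Finset.HasAntidiagonal.antidiagonal n, e p.1 * y p.2) atTop (nhds ((∑' i, e i) * L)) := by
  obtain ⟨M, hM⟩ := hy.norm.bddAbove_range
  have hM' : ∀ n, ‖y n‖ ≤ M := fun n => hM ⟨n, rfl⟩
  rw [← tsum_mul_right]
  have h := tendsto_tsum_of_dominated_convergence (𝓕 := atTop)
    (f := fun n i : ℕ => if i < n + 1 then e i * y (n - i) else 0) (g := fun i => e i * L)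
    (bound := fun i => ‖e i‖ * M) (he.norm.mul_right M) ?_ ?_
  · refine h.congr fun n => ?_
    rw [Finset.Nat.sum_antidiagonal_eq_sum_range_succ (fun i j => e i * y j),
      tsum_eq_sum (s := Finset.range (n + 1)) (fun i hi => if_neg (by simpa using hi))]
    exact Finset.sum_congr rfl fun i hi => if_pos (Finset.mem_range.mp hi)
  · intro i
    refine ((hy.comp (tendsto_sub_atTop_nat i)).const_mul (e i)).congr' ?_
    filter_upwards [eventually_ge_atTop i] with n hn
    simp [Nat.lt_succ_of_le hn]
  · refine Eventually.of_forall fun n i => ?_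
    split_ifs
    · rw [norm_mul]
      exact mul_le_mul_of_nonneg_left (hM' _) (norm_nonneg _)
    · rw [norm_zero]
      exact mul_nonneg (norm_nonneg _) ((norm_nonneg _).trans (hM' 0))

theorem sum_eulerCoeff {x : ℝ} (hx : 0 < x) (hx1 : x ≤ 1 / 2) (n : ℕ) :
    ∑ i ∈ Finset.range (n + 1), eulerCoeff x i = (∏ i ∈ Finset.Icc 1 n, (1 - x ^ i))⁻¹ := by
  induction n with
  | zero => simp [eulerCoeff]
  | succ n ih =>
    rw [Finset.sum_range_succ, ih, eulerCoeff, Finset.prod_Icc_succ_top (by omega)]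
    have h1 := (prod_one_sub_pow_pos hx hx1 n).ne'
    have h2 := (one_sub_pow_pos hx hx1 (i := n + 1) (by omega)).ne'
    field_simp
    ring

theorem tendsto_of_tendsto_eulerCoeff_convolution {x c : ℝ} (hx : 0 < x) (hx1 : x ≤ 1 / 2)
    (hc : Tendsto (fun n : ℕ => ∏ i ∈ Finset.Icc 1 n, (1 - x ^ i)) atTop (nhds c))
    {z : ℕ → ℝ} {L : ℝ}
    (h : Tendsto (fun n => ∑ p ∈ Finset.HasAntidiagonal.antidiagonal n, eulerCoeff x p.1 * z p.2) atTop (nhds L)) :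
    Tendsto z atTop (nhds (c * L)) := by
  have hc0 : c ≠ 0 := by
    have := ge_of_tendsto' hc (quarter_le_prod_one_sub_pow hx hx1)
    linarith
  have key : ∀ {z : ℕ → ℝ} {L : ℝ}, Tendsto (fun n => ∑ p ∈ Finset.HasAntidiagonal.antidiagonal n,
      eulerCoeff x p.1 * z p.2) atTop (nhds L) →
      Tendsto z atTop (nhds ((∑' i, eulerInvCoeff x i) * L)) := by
    intro z L h
    refine (tendsto_convolution (summable_eulerInvCoeff hx hx1) h).congr fun n => ?_
    have h1 : PowerSeries.mk (eulerInvCoeff x) *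
        (PowerSeries.mk (eulerCoeff x) * PowerSeries.mk z) = PowerSeries.mk z := by
      rw [← mul_assoc, eulerInvCoeff_mul_eulerCoeff hx hx1, one_mul]
    have h2 := congrArg (PowerSeries.coeff n) h1
    simpa only [PowerSeries.coeff_mul, PowerSeries.coeff_mk] using h2
  have h1 := key (z := fun _ => 1) (L := c⁻¹) (by
    refine (hc.inv₀ hc0).congr fun n => ?_
    rw [← sum_eulerCoeff hx hx1,
      Finset.Nat.sum_antidiagonal_eq_sum_range_succ (fun i _ => eulerCoeff x i * 1)]
    simp)
  have h2 := tendsto_nhds_unique h1 tendsto_const_nhds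
  rw [mul_inv_eq_one₀ hc0] at h2
  rw [← h2]
  exact key h

/-- The number of `n × n` matrices over `F` whose characteristic polynomial satisfies `P`,
divided by the order of `GL_n(F)`. -/
noncomputable def charpolyRatio (F : Type*) [Field F] (P : F[X] → Prop) (n : ℕ) : ℝ :=
  (Nat.card {A : Matrix (Fin n) (Fin n) F // P A.charpoly} : ℝ) / Nat.card (GL (Fin n) F)

theorem charpolyRatio_congr {F : Type*} [Field F] {P Q : F[X] → Prop} (h : ∀ p : F[X], p.Monic → (P p ↔ Q p)) (n : ℕ) :
    charpolyRatio F P n = charpolyRatio F Q n := by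
  unfold charpolyRatio
  rw [Nat.card_congr (Equiv.subtypeEquivRight fun A => h _ A.charpoly_monic)]

section charpolyRatio

variable {F : Type*} [Field F] [Fintype F]

variable (F) in
theorem inv_card_pos : (0 : ℝ) < ((Fintype.card F : ℝ))⁻¹ := by
  have : 0 < Fintype.card F := Fintype.card_pos
  positivity

variable (F) in
theorem inv_card_le_half : ((Fintype.card F : ℝ))⁻¹ ≤ 1 / 2 := by
  have hq : (2 : ℝ) ≤ Fintype.card F := by exact_mod_cast Fintype.one_lt_card
  rw [one_div]
  exact inv_anti₀ two_pos hq

theorem card_GL_pos (n : ℕ) : (0 : ℝ) < Nat.card (GL (Fin n) F) := by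
  exact_mod_cast Nat.card_pos

theorem card_GL_eq (n : ℕ) : (Nat.card (GL (Fin n) F) : ℝ) =
    (Fintype.card F : ℝ) ^ (n ^ 2) *
      ∏ i ∈ Finset.Icc 1 n, (1 - ((Fintype.card F : ℝ))⁻¹ ^ i) := by
  have hq : (Fintype.card F : ℝ) ≠ 0 := by exact_mod_cast Fintype.card_ne_zero
  have h1 : ∀ f : ℕ → ℝ, ∏ i ∈ Finset.Icc 1 n, f i = ∏ i ∈ Finset.range n, f (i + 1) := fun f => by
    rw [← Finset.Ico_add_one_right_eq_Icc, Finset.prod_Ico_eq_prod_range]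
    simp [add_comm]
  rw [card_GL_field, Nat.cast_prod, h1, ← Finset.prod_range_reflect,
    Fin.prod_univ_eq_prod_range
      (fun i => ((Fintype.card F ^ n - Fintype.card F ^ i : ℕ) : ℝ)) n, sq, pow_mul]
  conv_rhs => rw [← Finset.card_range n, ← Finset.prod_const, Finset.card_range,
    ← Finset.prod_mul_distrib]
  refine Finset.prod_congr rfl fun i hi => ?_
  have hi' := Finset.mem_range.mp hi
  rw [Nat.cast_sub (Nat.pow_le_pow_right Fintype.card_pos hi'.le),
    show n - 1 - i + 1 = n - i by omega, mul_sub, mul_one, inv_pow]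
  push_cast
  congr 1
  rw [← div_eq_mul_inv, eq_div_iff (pow_ne_zero _ hq), ← pow_add, Nat.add_sub_cancel' hi'.le]

theorem charpolyRatio_add (k l : ℕ) (lam : F) (Q : F[X] → Prop)
    (hQ : ∀ f : F[X], f.Monic → (Q ((X - C lam) ^ k * f) ↔ Q f)) :
    charpolyRatio F (fun p => p.rootMultiplicity lam = k ∧ Q p) (k + l) =
      charpolyRatio F (fun p => p = (X - C lam) ^ k) k *
        charpolyRatio F (fun p => p.eval lam ≠ 0 ∧ Q p) l := by
  have h := card_rootMultiplicity_mul_card_GL k l lam Q hQ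
  have h1 : Nat.card {A : Matrix (Fin k ⊕ Fin l) (Fin k ⊕ Fin l) F //
        A.charpoly.rootMultiplicity lam = k ∧ Q A.charpoly} =
      Nat.card {A : Matrix (Fin (k + l)) (Fin (k + l)) F //
        A.charpoly.rootMultiplicity lam = k ∧ Q A.charpoly} :=
    Nat.card_congr ((reindex finSumFinEquiv finSumFinEquiv).subtypeEquiv fun A => by
      rw [charpoly_reindex])
  have h2 : Nat.card (Matrix (Fin k ⊕ Fin l) (Fin k ⊕ Fin l) F)ˣ =
      Nat.card (GL (Fin (k + l)) F) :=
    Nat.card_congr (Units.mapEquiv (reindexAlgEquiv F F finSumFinEquiv).toMulEquiv).toEquiv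
  rw [h1, h2] at h
  unfold charpolyRatio
  have hk := (card_GL_pos (F := F) k).ne'
  have hl := (card_GL_pos (F := F) l).ne'
  have hkl := (card_GL_pos (F := F) (k + l)).ne'
  have h' := congrArg (Nat.cast : ℕ → ℝ) h
  push_cast at h'
  field_simp
  linear_combination h'

theorem charpolyRatio_eq_sum (n : ℕ) (lam : F) (Q : F[X] → Prop)
    (hQ : ∀ k, ∀ f : F[X], f.Monic → (Q ((X - C lam) ^ k * f) ↔ Q f)) :
    charpolyRatio F Q n = ∑ p ∈ Finset.HasAntidiagonal.antidiagonal n,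
      charpolyRatio F (fun f => f = (X - C lam) ^ p.1) p.1 *
        charpolyRatio F (fun f => f.eval lam ≠ 0 ∧ Q f) p.2 := by
  classical
  have h1 : Nat.card {A : Matrix (Fin n) (Fin n) F // Q A.charpoly} =
      ∑ p ∈ Finset.HasAntidiagonal.antidiagonal n, Nat.card {A : Matrix (Fin n) (Fin n) F //
        A.charpoly.rootMultiplicity lam = p.1 ∧ Q A.charpoly} := by
    rw [Finset.Nat.sum_antidiagonal_eq_sum_range_succ (fun k _ => Nat.card
      {A : Matrix (Fin n) (Fin n) F // A.charpoly.rootMultiplicity lam = k ∧ Q A.charpoly})]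
    simp_rw [Nat.card_eq_fintype_card, Fintype.card_subtype]
    rw [Finset.card_eq_sum_card_fiberwise (t := Finset.range (n + 1))
      (f := fun A => A.charpoly.rootMultiplicity lam)]
    · refine Finset.sum_congr rfl fun k _ => ?_
      rw [Finset.filter_filter]
      simp_rw [and_comm]
    · intro A _
      have h2 := (Multiset.count_le_card lam _).trans A.charpoly.card_roots'
      rw [count_roots, charpoly_natDegree_eq_dim, Fintype.card_fin] at h2
      simpa using Nat.lt_succ_of_le h2
  have h3 : charpolyRatio F Q n = ∑ p ∈ Finset.HasAntidiagonal.antidiagonal n,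
      charpolyRatio F (fun f => f.rootMultiplicity lam = p.1 ∧ Q f) n := by
    simp only [charpolyRatio]
    rw [h1, ← Finset.sum_div]
    push_cast
    rfl
  rw [h3]
  refine Finset.sum_congr rfl fun p hp => ?_
  rw [← Finset.HasAntidiagonal.mem_antidiagonal.mp hp]
  exact charpolyRatio_add p.1 p.2 lam Q (hQ _)

theorem charpolyRatio_true (n : ℕ) : charpolyRatio F (fun _ => True) n =
    (∏ i ∈ Finset.Icc 1 n, (1 - ((Fintype.card F : ℝ))⁻¹ ^ i))⁻¹ := by
  have hq : (Fintype.card F : ℝ) ≠ 0 := by exact_mod_cast Fintype.card_ne_zero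
  have h : Nat.card {A : Matrix (Fin n) (Fin n) F // True} = Fintype.card F ^ (n ^ 2) := by
    rw [Nat.card_congr (Equiv.subtypeUnivEquiv fun _ => trivial), Nat.card_eq_fintype_card]
    rw [show Fintype.card (Matrix (Fin n) (Fin n) F) = Fintype.card (Fin n → Fin n → F) from
      Fintype.card_congr (Matrix.of).symm]
    simp [sq, pow_mul]
  rw [charpolyRatio, h, card_GL_eq, Nat.cast_pow, div_mul_eq_div_div, div_self (pow_ne_zero _ hq),
    one_div]

theorem charpolyRatio_eval_ne_zero (lam : F) (n : ℕ) :
    charpolyRatio F (fun p => p.eval lam ≠ 0 ∧ True) n = 1 := by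
  have h : Nat.card {A : Matrix (Fin n) (Fin n) F // A.charpoly.eval lam ≠ 0 ∧ True} =
      Nat.card (GL (Fin n) F) := by
    have e : GL (Fin n) F ≃ {A : Matrix (Fin n) (Fin n) F // IsUnit A} :=
      Equiv.ofInjective _ Units.val_injective
    rw [Nat.card_congr e]
    refine Nat.card_congr ((Equiv.subLeft (scalar (Fin n) lam)).subtypeEquiv fun A => ?_)
    rw [and_true, eval_charpoly, Equiv.subLeft_apply, isUnit_iff_isUnit_det, isUnit_iff_ne_zero]
  rw [charpolyRatio, h, div_self (card_GL_pos n).ne']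

theorem charpolyRatio_X_sub_C_pow (lam : F) (n : ℕ) :
    charpolyRatio F (fun p => p = (X - C lam) ^ n) n =
      eulerCoeff ((Fintype.card F : ℝ))⁻¹ n := by
  have hx := inv_card_pos F
  have hx1 := inv_card_le_half F
  have key : ∀ n, ∑ i ∈ Finset.range (n + 1), charpolyRatio F (fun p => p = (X - C lam) ^ i) i =
      ∑ i ∈ Finset.range (n + 1), eulerCoeff ((Fintype.card F : ℝ))⁻¹ i := by
    intro n
    have h := charpolyRatio_eq_sum n lam (fun _ => True) (by simp)
    simp only [charpolyRatio_eval_ne_zero, mul_one] at h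
    rw [sum_eulerCoeff hx hx1, ← charpolyRatio_true, h,
      Finset.Nat.sum_antidiagonal_eq_sum_range_succ
        (fun i _ => charpolyRatio F (fun p => p = (X - C lam) ^ i) i)]
  cases n with
  | zero => simpa using key 0
  | succ n =>
    have h := key (n + 1)
    rw [Finset.sum_range_succ, key n, Finset.sum_range_succ _ (n + 1)] at h
    exact add_left_cancel h

theorem tendsto_charpolyRatio {c : ℝ}
    (hc : Tendsto (fun n : ℕ => ∏ i ∈ Finset.Icc 1 n, (1 - ((Fintype.card F : ℝ))⁻¹ ^ i))
      atTop (nhds c)) (m : F → ℕ) (S : Finset F) :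
    Tendsto (charpolyRatio F fun p => ∀ a ∈ S, p.rootMultiplicity a = m a) atTop
      (nhds (c⁻¹ * ∏ a ∈ S, (c * eulerCoeff ((Fintype.card F : ℝ))⁻¹ (m a)))) := by
  classical
  have hx := inv_card_pos F
  have hx1 := inv_card_le_half F
  induction S using Finset.induction_on with
  | empty =>
    have hc0 : c ≠ 0 := by
      have := ge_of_tendsto' hc (quarter_le_prod_one_sub_pow hx hx1)
      linarith
    simp only [Finset.notMem_empty, false_imp_iff, implies_true, Finset.prod_empty, mul_one]
    exact (hc.inv₀ hc0).congr fun n => (charpolyRatio_true n).symm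
  | insert lam S hlam ih =>
    have hQ : ∀ k, ∀ f : F[X], f.Monic →
        ((∀ a ∈ S, ((X - C lam) ^ k * f).rootMultiplicity a = m a) ↔
          ∀ a ∈ S, f.rootMultiplicity a = m a) := by
      intro k f hf
      refine forall₂_congr fun a ha => ?_
      rw [rootMultiplicity_mul (mul_ne_zero (pow_ne_zero _ (X_sub_C_ne_zero _)) hf.ne_zero),
        rootMultiplicity_eq_zero (p := (X - C lam) ^ k), zero_add]
      have : a ≠ lam := fun h => hlam (h ▸ ha)
      simp [sub_eq_zero, this]
    have h1 := tendsto_of_tendsto_eulerCoeff_convolution hx hx1 hc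
      (z := charpolyRatio F fun p => p.eval lam ≠ 0 ∧ ∀ a ∈ S, p.rootMultiplicity a = m a)
      (ih.congr fun n =>
      (charpolyRatio_eq_sum n lam _ hQ).trans (by simp only [charpolyRatio_X_sub_C_pow]))
    rw [← tendsto_add_atTop_iff_nat (m lam), Finset.prod_insert hlam]
    have h2 := h1.const_mul (eulerCoeff ((Fintype.card F : ℝ))⁻¹ (m lam))
    convert h2 using 1
    · ext n
      rw [← charpolyRatio_X_sub_C_pow lam, add_comm, ← charpolyRatio_add _ _ _ _ (hQ _)]
      simp only [Finset.forall_mem_insert]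
    · congr 1
      ring

end charpolyRatio

theorem exists_eq_mul_prod_X_sub_C_pow_iff {F : Type*} [Field F] [Fintype F] (m : F → ℕ)
    {p : F[X]} (hp : p.Monic) :
    (∃ f₀ : F[X], f₀.Monic ∧ (∀ t : F, f₀.eval t ≠ 0) ∧
      p = f₀ * ∏ lam : F, (X - C lam) ^ m lam) ↔
    ∀ a ∈ (Finset.univ : Finset F), p.rootMultiplicity a = m a := by
  classical
  have hprod : (∏ lam : F, (X - C lam) ^ m lam).Monic :=
    monic_prod_of_monic _ _ fun a _ => (monic_X_sub_C a).pow _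
  constructor
  · rintro ⟨f, hf, hev, rfl⟩ a -
    rw [← Finset.mul_prod_erase _ _ (Finset.mem_univ a), mul_left_comm,
      rootMultiplicity_X_sub_C_pow_mul]
    rw [eval_mul, eval_prod]
    refine mul_ne_zero (hev a) (Finset.prod_ne_zero_iff.mpr fun b hb => ?_)
    simp [sub_eq_zero, (Finset.ne_of_mem_erase hb).symm]
  · intro h
    obtain ⟨f, hf, -, hroots⟩ := exists_prod_multiset_X_sub_C_mul p
    rw [Finset.prod_multiset_map_count] at hf
    have h1 : ∏ a ∈ p.roots.toFinset, (X - C a) ^ p.roots.count a =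
        ∏ lam : F, (X - C lam) ^ m lam := by
      rw [← Finset.prod_subset (Finset.subset_univ p.roots.toFinset)]
      · exact Finset.prod_congr rfl fun a _ => by rw [count_roots, h a (Finset.mem_univ a)]
      · intro a _ ha
        rw [← h a (Finset.mem_univ a), ← count_roots,
          Multiset.count_eq_zero_of_notMem (by simpa using ha), pow_zero]
    rw [h1] at hf
    have hfm : f.Monic := hprod.of_mul_monic_left (hf ▸ hp)
    refine ⟨f, hfm, fun t ht => ?_, by rw [← hf, mul_comm]⟩
    have : t ∈ f.roots := (mem_roots hfm.ne_zero).mpr ht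
    simp [hroots] at this

/-- For a fixed eigenvalue multiplicity profile `m : F_q → ℕ`, the probability
`α_m(n, q) := |C_m(n, q)| / q^{n²}` converges as `n → ∞` to
`c(q)^q · ∏_λ q^{−m(λ)} / c_{m(λ)}(q)`, where `c_k(q) = ∏_{i=1}^k (1 − q^{−i})` and
`c(q)` is their limit. -/
theorem stmt_7 (F : Type*) [Field F] [Fintype F] (q : ℕ) (hq : Fintype.card F = q)
    (m : F → ℕ) (c : ℝ)
    (hc : Tendsto (fun n : ℕ => ∏ i ∈ Finset.Icc 1 n, (1 - ((q : ℝ))⁻¹ ^ i)) atTop (nhds c)) :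
    Tendsto (fun n : ℕ =>
        (Nat.card {A : Matrix (Fin n) (Fin n) F //
            ∃ f₀ : Polynomial F, f₀.Monic ∧ (∀ t : F, f₀.eval t ≠ 0) ∧
              A.charpoly = f₀ * ∏ lam : F, (X - C lam) ^ m lam} : ℝ)
          / (q : ℝ) ^ (n ^ 2))
      atTop
      (nhds (c ^ q * ∏ lam : F,
        ((q : ℝ))⁻¹ ^ m lam / ∏ i ∈ Finset.Icc 1 (m lam), (1 - ((q : ℝ))⁻¹ ^ i))) := by
  subst hq
  have hx := inv_card_pos F
  have hx1 := inv_card_le_half F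
  have hc0 : c ≠ 0 := by
    have := ge_of_tendsto' hc (quarter_le_prod_one_sub_pow hx hx1)
    linarith
  have h := hc.mul (tendsto_charpolyRatio hc m Finset.univ)
  rw [mul_inv_cancel_left₀ hc0, Finset.prod_mul_distrib, Finset.prod_const,
    Finset.card_univ] at h
  refine h.congr fun n => ?_
  rw [← charpolyRatio_congr fun p hp => exists_eq_mul_prod_X_sub_C_pow_iff m hp, charpolyRatio,
    card_GL_eq]
  have h1 := (prod_one_sub_pow_pos hx hx1 n).ne'
  rw [mul_comm, div_mul_eq_mul_div, mul_div_mul_right _ _ h1]
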